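/- For every ε > 0 there exists δ > 0 such that for every λ with λ₀ − δ < λ ≤ λ₀, there are at least three distinct real numbers α for which the solution u_α of (∗) with u_α(0) = α, u_α'(0) = 0 is defined on [0, π] and satisfies u_α'(π) = 0. (In particular, λ_b := sup{λ : (∗) has only one solution with u'(0) = 0 and u'(π) = 0} is strictly less than λ₀.) -/

import Mathlib

open Real Set

/-- `p` and `q` are the first and second derivatives of `u` on the line, and `q` is continuous. -/
structure HasTwoDerivs (u p q : ℝ → ℝ) : Prop where
  fst (t : ℝ) : HasDerivAt u (p t) t
  snd (t : ℝ) : HasDerivAt p (q t) t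
  cont : Continuous q

namespace HasTwoDerivs

variable {u p q v r s : ℝ → ℝ}

lemma cont_fst (h : HasTwoDerivs u p q) : Continuous u :=
  continuous_iff_continuousAt.2 fun t ↦ (h.fst t).continuousAt

lemma cont_snd (h : HasTwoDerivs u p q) : Continuous p :=
  continuous_iff_continuousAt.2 fun t ↦ (h.snd t).continuousAt

lemma deriv_eq (h : HasTwoDerivs u p q) : deriv u = p := funext fun t ↦ (h.fst t).deriv

lemma deriv_deriv_eq (h : HasTwoDerivs u p q) : deriv (deriv u) = q := by
  rw [h.deriv_eq]; exact funext fun t ↦ (h.snd t).deriv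

lemma contDiff (h : HasTwoDerivs u p q) : ContDiff ℝ 2 u := by
  rw [show (2 : WithTop ℕ∞) = 1 + 1 by norm_num, contDiff_succ_iff_deriv]
  refine ⟨fun t ↦ (h.fst t).differentiableAt, by simp, ?_⟩
  rw [h.deriv_eq, contDiff_one_iff_deriv]
  refine ⟨fun t ↦ (h.snd t).differentiableAt, ?_⟩
  rw [← h.deriv_eq, h.deriv_deriv_eq]
  exact h.cont

lemma sub (h : HasTwoDerivs u p q) (k : HasTwoDerivs v r s) :
    HasTwoDerivs (fun t ↦ u t - v t) (fun t ↦ p t - r t) (fun t ↦ q t - s t) :=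
  ⟨fun t ↦ (h.fst t).sub (k.fst t), fun t ↦ (h.snd t).sub (k.snd t), h.cont.sub k.cont⟩

lemma comp_const_sub (h : HasTwoDerivs u p q) (T : ℝ) :
    HasTwoDerivs (fun t ↦ u (T - t)) (fun t ↦ -p (T - t)) (fun t ↦ q (T - t)) where
  fst t := (h.fst (T - t)).comp_const_sub T t
  snd t := by
    have := ((h.snd (T - t)).comp_const_sub T t).fun_neg
    rwa [neg_neg] at this
  cont := h.cont.comp (by fun_prop)

lemma neg (h : HasTwoDerivs u p q) :
    HasTwoDerivs (fun t ↦ -u t) (fun t ↦ -p t) (fun t ↦ -q t) :=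
  ⟨fun t ↦ (h.fst t).neg, fun t ↦ (h.snd t).neg, h.cont.neg⟩

lemma const (c : ℝ) : HasTwoDerivs (fun _ ↦ c) (fun _ ↦ 0) (fun _ ↦ 0) :=
  ⟨fun t ↦ hasDerivAt_const t c, fun t ↦ hasDerivAt_const t 0, continuous_const⟩

lemma exists_of_continuous (hq : Continuous q) (α β : ℝ) :
    ∃ u p, HasTwoDerivs u p q ∧ u 0 = α ∧ p 0 = β := by
  have hp (t : ℝ) : HasDerivAt (fun t ↦ β + ∫ s in (0 : ℝ)..t, q s) (q t) t :=
    ((hq.integral_hasStrictDerivAt 0 t).hasDerivAt).const_add β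
  have hpc : Continuous (fun t ↦ β + ∫ s in (0 : ℝ)..t, q s) :=
    continuous_iff_continuousAt.2 fun t ↦ (hp t).continuousAt
  exact ⟨fun t ↦ α + ∫ s in (0 : ℝ)..t, (β + ∫ x in (0 : ℝ)..s, q x), _,
    ⟨fun t ↦ ((hpc.integral_hasStrictDerivAt 0 t).hasDerivAt).const_add α, hp, hq⟩,
    by simp, by simp⟩

/-- If `y'' < 0` wherever `y ≤ 0`, then once `y ≤ 0` and `y' ≤ 0`, the function `y` keeps
decreasing. -/
lemma decreasing_of_nonpos {y y1 y2 : ℝ → ℝ} (h : HasTwoDerivs y y1 y2) {a b : ℝ} (hab : a < b)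
    (hy : ∀ t ∈ Icc a b, y t ≤ 0 → y2 t < 0) (h0 : y a ≤ 0) (h1 : y1 a ≤ 0) :
    y1 b < 0 ∧ y b ≤ y a := by
  have anti1 {c d : ℝ} (hneg : ∀ t ∈ Ioo c d, y2 t < 0) : StrictAntiOn y1 (Icc c d) := by
    refine strictAntiOn_of_deriv_neg (convex_Icc c d) h.cont_snd.continuousOn fun t ht ↦ ?_
    rw [interior_Icc] at ht
    rw [(h.snd t).deriv]; exact hneg t ht
  have anti0 {c d : ℝ} (hneg : ∀ t ∈ Ioo c d, y1 t ≤ 0) : AntitoneOn y (Icc c d) := by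
    refine antitoneOn_of_deriv_nonpos (convex_Icc c d) h.cont_fst.continuousOn
      (fun t _ ↦ (h.fst t).differentiableAt.differentiableWithinAt) fun t ht ↦ ?_
    rw [interior_Icc] at ht
    rw [(h.fst t).deriv]; exact hneg t ht
  have key : Icc a b ⊆ {t | y t ≤ 0 ∧ y1 t ≤ 0} := by
    refine IsClosed.Icc_subset_of_forall_exists_gt (IsClosed.inter ?_ isClosed_Icc) ⟨h0, h1⟩ ?_
    · exact (isClosed_le h.cont_fst continuous_const).inter
        (isClosed_le h.cont_snd continuous_const)
    · rintro x ⟨⟨hx0, hx1⟩, hxI⟩ z hz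
      have hx2 : y2 x < 0 := hy x (Ico_subset_Icc_self hxI) hx0
      obtain ⟨δ, hδ, hball⟩ := Metric.eventually_nhds_iff.1
        (h.cont.continuousAt.eventually_lt continuousAt_const hx2)
      set c := min z (x + δ)
      have hxc : x < c := lt_min hz (by linarith)
      have hneg : ∀ t ∈ Ioo x c, y2 t < 0 := fun t ht ↦ hball (by
        have := min_le_right z (x + δ)
        rw [Real.dist_eq, abs_lt]; constructor <;> linarith [ht.1, ht.2])
      have a1 := anti1 hneg
      have hle : ∀ t ∈ Icc x c, y1 t ≤ 0 := fun t ht ↦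
        (a1.antitoneOn (left_mem_Icc.2 hxc.le) ht ht.1).trans hx1
      have a0 := anti0 fun t ht ↦ hle t (Ioo_subset_Icc_self ht)
      have hcI := right_mem_Icc.2 hxc.le
      exact ⟨c, ⟨(a0 (left_mem_Icc.2 hxc.le) hcI hxc.le).trans hx0, hle c hcI⟩,
        hxc, min_le_left _ _⟩
  have hI := left_mem_Icc.2 hab.le
  have hI' := right_mem_Icc.2 hab.le
  refine ⟨(anti1 (fun t ht ↦ ?_) hI hI' hab).trans_le h1,
    anti0 (fun t ht ↦ (key (Ioo_subset_Icc_self ht)).2) hI hI' hab.le⟩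
  exact hy t (Ioo_subset_Icc_self ht) (key (Ioo_subset_Icc_self ht)).1

/-- Time-reversed form of `decreasing_of_nonpos`. -/
lemma increasing_of_nonpos {y y1 y2 : ℝ → ℝ} (h : HasTwoDerivs y y1 y2) {a b : ℝ} (hab : a < b)
    (hy : ∀ t ∈ Icc a b, y t ≤ 0 → y2 t < 0) (h0 : y b ≤ 0) (h1 : 0 ≤ y1 b) :
    0 < y1 a := by
  have := ((h.comp_const_sub (a + b)).decreasing_of_nonpos hab
    (fun t ht ↦ hy (a + b - t) ⟨by linarith [ht.2], by linarith [ht.1]⟩)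
    (by simpa using h0) (by simpa using h1)).1
  simpa using this

lemma pos_of_neumann {y y1 y2 : ℝ → ℝ} (h : HasTwoDerivs y y1 y2) {T : ℝ} (hT : 0 < T)
    (hy : ∀ t ∈ Icc 0 T, y t ≤ 0 → y2 t < 0) (h0 : y1 0 = 0) (h1 : y1 T = 0) :
    ∀ t ∈ Icc 0 T, 0 < y t := by
  intro t ht
  by_contra! hle
  have sub1 : ∀ s ∈ Icc 0 t, y s ≤ 0 → y2 s < 0 := fun s hs ↦ hy s ⟨hs.1, hs.2.trans ht.2⟩
  have sub2 : ∀ s ∈ Icc t T, y s ≤ 0 → y2 s < 0 := fun s hs ↦ hy s ⟨ht.1.trans hs.1, hs.2⟩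
  rcases ht.1.eq_or_lt with rfl | ht0
  · linarith [(h.decreasing_of_nonpos hT hy hle h0.le).1]
  rcases ht.2.eq_or_lt with rfl | htT
  · linarith [h.increasing_of_nonpos hT hy hle h1.ge]
  rcases le_total (y1 t) 0 with h' | h'
  · linarith [(h.decreasing_of_nonpos htT sub2 hle h').1]
  · linarith [h.increasing_of_nonpos ht0 sub1 hle h']

lemma pos_of_mixed {y y1 y2 : ℝ → ℝ} (h : HasTwoDerivs y y1 y2) {T : ℝ}
    (hy : ∀ t ∈ Icc 0 T, y t ≤ 0 → y2 t < 0) (h0 : y1 0 = 0) (h1 : 0 < y T) :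
    ∀ t ∈ Icc 0 T, 0 < y t := by
  intro t ht
  by_contra! hle
  have sub1 : ∀ s ∈ Icc 0 t, y s ≤ 0 → y2 s < 0 := fun s hs ↦ hy s ⟨hs.1, hs.2.trans ht.2⟩
  have sub2 : ∀ s ∈ Icc t T, y s ≤ 0 → y2 s < 0 := fun s hs ↦ hy s ⟨ht.1.trans hs.1, hs.2⟩
  rcases ht.2.eq_or_lt with rfl | htT
  · linarith
  rcases le_or_gt (y1 t) 0 with h' | h'
  · linarith [(h.decreasing_of_nonpos htT sub2 hle h').2]
  rcases ht.1.eq_or_lt with rfl | ht0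
  · linarith
  · linarith [h.increasing_of_nonpos ht0 sub1 hle h'.le]

end HasTwoDerivs

/-- `f` up to time `c`, and `g` afterwards. -/
lemma hasDerivAt_glue {f g f' g' : ℝ → ℝ} {c : ℝ} (hf : ∀ t, HasDerivAt f (f' t) t)
    (hg : ∀ t, HasDerivAt g (g' t) t) (h0 : f c = g c) (h1 : f' c = g' c) (t : ℝ) :
    HasDerivAt (fun t ↦ if t ≤ c then f t else g t) (if t ≤ c then f' t else g' t) t := by
  rcases lt_trichotomy t c with h | rfl | h
  · rw [if_pos h.le]
    exact (hf t).congr_of_eventuallyEq ((eventually_le_nhds h).mono fun s hs ↦ if_pos hs)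
  · rw [if_pos le_rfl, ← hasDerivWithinAt_univ, ← Iic_union_Ici (a := t)]
    refine HasDerivWithinAt.union ((hf t).hasDerivWithinAt.congr
      (fun s (hs : s ≤ t) ↦ if_pos hs) (if_pos le_rfl)) ?_
    rw [h1]
    refine (hg t).hasDerivWithinAt.congr (fun s hs ↦ ?_) (by rw [if_pos le_rfl, h0])
    rcases (mem_Ici.1 hs).eq_or_lt with rfl | hs
    · rw [if_pos le_rfl, h0]
    · rw [if_neg hs.not_ge]
  · rw [if_neg h.not_ge]
    exact (hg t).congr_of_eventuallyEq ((eventually_gt_nhds h).mono fun s hs ↦ if_neg hs.not_ge)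

lemma HasTwoDerivs.glue {u p q v r s : ℝ → ℝ} {c : ℝ} (h : HasTwoDerivs u p q)
    (k : HasTwoDerivs v r s) (h0 : u c = v c) (h1 : p c = r c) (h2 : q c = s c) :
    HasTwoDerivs (fun t ↦ if t ≤ c then u t else v t) (fun t ↦ if t ≤ c then p t else r t)
      (fun t ↦ if t ≤ c then q t else s t) :=
  ⟨hasDerivAt_glue h.fst k.fst h0 h1, hasDerivAt_glue h.snd k.snd h1 h2,
    h.cont.if_le k.cont continuous_id continuous_const (by rintro x rfl; exact h2)⟩

open scoped NNReal

/-- The scalar second order equation `u'' = F t u` as a first order system, with the velocity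
truncated at height `P`. -/
def truncatedField (F : ℝ → ℝ → ℝ) (P : ℝ) (t : ℝ) (x : ℝ × ℝ) : ℝ × ℝ :=
  (max (-P) (min x.2 P), F t x.1)

lemma abs_clamp_sub_clamp_le (a b x y : ℝ) :
    |max a (min x b) - max a (min y b)| ≤ |x - y| :=
  (abs_max_sub_max_le_max a (min x b) a (min y b)).trans <| by
    rw [sub_self, abs_zero, max_eq_right (abs_nonneg _)]
    refine (abs_min_sub_min_le_max x b y b).trans ?_
    rw [sub_self, abs_zero, max_eq_left (abs_nonneg _)]

lemma lipschitzWith_truncatedField {F : ℝ → ℝ → ℝ} {K : ℝ≥0} (hF : ∀ t, LipschitzWith K (F t))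
    (P t : ℝ) : LipschitzWith (max 1 K) (truncatedField F P t) := by
  have h1 : LipschitzWith 1 (fun x : ℝ × ℝ ↦ max (-P) (min x.2 P)) := by
    refine LipschitzWith.of_dist_le_mul fun x y ↦ ?_
    rw [Real.dist_eq, NNReal.coe_one, one_mul]
    exact (abs_clamp_sub_clamp_le _ _ _ _).trans (le_max_right (dist x.1 y.1) _)
  have h2 := (hF t).comp (LipschitzWith.prod_fst (α := ℝ) (β := ℝ))
  rw [mul_one] at h2
  exact h1.prodMk h2

/-- Global flow of `u'' = F t u`, `u'(0) = 0`, for a bounded Lipschitz nonlinearity. -/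
lemma exists_shooting_family {F : ℝ → ℝ → ℝ} {K : ℝ≥0} {B T R : ℝ}
    (hFc : ∀ x, Continuous (F · x)) (hFl : ∀ t, LipschitzWith K (F t))
    (hFB : ∀ t x, |F t x| ≤ B) (hT : 0 < T) (hR : 0 ≤ R) :
    ∃ u p q : ℝ → ℝ → ℝ,
      (∀ α ∈ Icc (-R) R, HasTwoDerivs (u α) (p α) (q α) ∧ u α 0 = α ∧ p α 0 = 0 ∧
        ∀ t ∈ Icc 0 T, q α t = F t (u α t)) ∧
      ∀ t ∈ Icc 0 T, ContinuousOn (u · t) (Icc (-R) R) ∧ ContinuousOn (p · t) (Icc (-R) R) := by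
  have hB : 0 ≤ B := (abs_nonneg _).trans (hFB 0 0)
  have hP : 0 ≤ B * T := by positivity
  have hF2 : Continuous (fun x : ℝ × ℝ ↦ F x.1 x.2) :=
    continuous_prod_of_continuous_lipschitzWith' _ K hFl hFc
  have h0 : (0 : ℝ) ∈ Icc 0 T := left_mem_Icc.2 hT.le
  have hPL : IsPicardLindelof (truncatedField F (B * T)) (⟨0, h0⟩ : Icc (0 : ℝ) T) 0
      (.mk ((B * T + B) * T + R) (by positivity)) (.mk R hR) (.mk (B * T + B) (by positivity))
      (max 1 K) := by
    refine ⟨fun t _ ↦ (lipschitzWith_truncatedField hFl _ t).lipschitzOnWith,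
      fun x _ ↦ (continuous_const.prodMk (hFc x.1)).continuousOn, fun t _ x _ ↦ ?_, ?_⟩
    · refine max_le ?_ ?_
      · rw [Real.norm_eq_abs, NNReal.coe_mk, abs_le]
        constructor
        · exact (show -(B * T + B) ≤ -(B * T) by linarith).trans (le_max_left _ _)
        · refine max_le (by linarith) ((min_le_right _ _).trans (by linarith))
      · exact (hFB t x.1).trans (by simpa using hP)
    · simp [max_eq_left hT.le]
  obtain ⟨Φ, hΦ, L, hL⟩ :=
    hPL.exists_forall_mem_closedBall_eq_hasDerivWithinAt_lipschitzOnWith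
  have hball {α : ℝ} (hα : α ∈ Icc (-R) R) :
      ((α, 0) : ℝ × ℝ) ∈ Metric.closedBall (0 : ℝ × ℝ) (NNReal.mk R hR : ℝ) := by
    rw [mem_closedBall_zero_iff]
    exact max_le (abs_le.2 hα) (by simpa using hR)
  have hex (α : ℝ) : ∃ upq : (ℝ → ℝ) × (ℝ → ℝ) × (ℝ → ℝ), α ∈ Icc (-R) R →
      HasTwoDerivs upq.1 upq.2.1 upq.2.2 ∧ upq.1 0 = α ∧ upq.2.1 0 = 0 ∧
      (∀ t ∈ Icc 0 T, upq.2.2 t = F t (upq.1 t)) ∧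
      ∀ t ∈ Icc 0 T, upq.1 t = (Φ (α, 0) t).1 ∧ upq.2.1 t = (Φ (α, 0) t).2 := by
    by_cases hα : α ∈ Icc (-R) R
    swap
    · exact ⟨⟨0, 0, 0⟩, fun h ↦ absurd h hα⟩
    obtain ⟨hi, hd⟩ := hΦ _ (hball hα)
    set x := Φ (α, 0)
    have hxc : ContinuousOn x (Icc 0 T) := HasDerivWithinAt.continuousOn hd
    have hx1 : ContinuousOn (fun t ↦ (x t).1) (Icc 0 T) := continuous_fst.comp_continuousOn hxc
    have hx2 : ContinuousOn (fun t ↦ (x t).2) (Icc 0 T) := continuous_snd.comp_continuousOn hxc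
    have hd1 (t) (ht : t ∈ Icc 0 T) : HasDerivWithinAt (fun t ↦ (x t).1)
        (max (-(B * T)) (min (x t).2 (B * T))) (Icc 0 T) t := (hd t ht).fst
    have hd2 (t) (ht : t ∈ Icc 0 T) : HasDerivWithinAt (fun t ↦ (x t).2)
        (F t (x t).1) (Icc 0 T) t := (hd t ht).snd
    have hbd (t) (ht : t ∈ Icc 0 T) : |(x t).2| ≤ B * T := by
      have := (convex_Icc 0 T).norm_image_sub_le_of_norm_hasDerivWithin_le hd2
        (fun t _ ↦ hFB t _) h0 ht
      have h2 : (x 0).2 = 0 := by rw [hi]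
      rw [h2, sub_zero, sub_zero, Real.norm_eq_abs, Real.norm_eq_abs, abs_of_nonneg ht.1] at this
      exact this.trans (by gcongr; exact ht.2)
    obtain ⟨u, p, h, hu0, hp0⟩ := HasTwoDerivs.exists_of_continuous
      (q := IccExtend hT.le fun t : Icc 0 T ↦ F t (x t).1)
      (Continuous.Icc_extend' (hF2.comp
        (continuous_subtype_val.prodMk (continuousOn_iff_continuous_domRestrict.1 hx1)))) α 0
    have hq (t) (ht : t ∈ Icc 0 T) : IccExtend hT.le (fun t : Icc 0 T ↦ F t (x t).1) t =
        F t (x t).1 := IccExtend_of_mem _ _ ht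
    have toIci {f : ℝ → ℝ} {f' t : ℝ} (ht : t ∈ Ico 0 T)
        (hf : HasDerivWithinAt f f' (Icc 0 T) t) : HasDerivWithinAt f f' (Ici t) t :=
      hf.mono_of_mem_nhdsWithin (Icc_mem_nhdsGE_of_mem ht)
    have hp : ∀ t ∈ Icc 0 T, p t = (x t).2 := by
      refine eq_of_has_deriv_right_eq (fun t ht ↦ (h.snd t).hasDerivWithinAt) (fun t ht ↦ ?_)
        h.cont_snd.continuousOn hx2 (by rw [hp0, hi])
      rw [hq t (Ico_subset_Icc_self ht)]
      exact toIci ht (hd2 t (Ico_subset_Icc_self ht))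
    have hu : ∀ t ∈ Icc 0 T, u t = (x t).1 := by
      refine eq_of_has_deriv_right_eq (fun t ht ↦ (h.fst t).hasDerivWithinAt) (fun t ht ↦ ?_)
        h.cont_fst.continuousOn hx1 (by rw [hu0, hi])
      have ht' := Ico_subset_Icc_self ht
      have hb := abs_le.1 (hbd t ht')
      have := toIci ht (hd1 t ht')
      rwa [min_eq_left hb.2, max_eq_right hb.1, ← hp t ht'] at this
    exact ⟨(u, p, _), fun _ ↦ ⟨h, hu0, hp0, fun t ht ↦
      (hq t ht).trans (congrArg (F t) (hu t ht).symm),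
      fun t ht ↦ ⟨hu t ht, hp t ht⟩⟩⟩
  choose U hU using hex
  have hΦc (t) (ht : t ∈ Icc 0 T) : ContinuousOn (fun α ↦ Φ (α, 0) t) (Icc (-R) R) :=
    (hL t ht).continuousOn.comp (by fun_prop) fun α hα ↦ hball hα
  refine ⟨fun α ↦ (U α).1, fun α ↦ (U α).2.1, fun α ↦ (U α).2.2, fun α hα ↦ ?_, fun t ht ↦ ?_⟩
  · obtain ⟨h1, h2, h3, h4, -⟩ := hU α hα
    exact ⟨h1, h2, h3, h4⟩
  · exact ⟨(continuous_fst.comp_continuousOn (hΦc t ht)).congr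
        fun α hα ↦ ((hU α hα).2.2.2.2 t ht).1,
      (continuous_snd.comp_continuousOn (hΦc t ht)).congr
        fun α hα ↦ ((hU α hα).2.2.2.2 t ht).2⟩

/-- Initial data determine the solution of `u'' = F t u` for Lipschitz `F`. -/
lemma HasTwoDerivs.eqOn_of_initial {F : ℝ → ℝ → ℝ} {K : ℝ≥0} {T : ℝ} {u p q v r s : ℝ → ℝ}
    (hFl : ∀ t, LipschitzWith K (F t))
    (h : HasTwoDerivs u p q) (k : HasTwoDerivs v r s) (hq : ∀ t ∈ Icc 0 T, q t = F t (u t))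
    (hs : ∀ t ∈ Icc 0 T, s t = F t (v t)) (h0 : u 0 = v 0) (h1 : p 0 = r 0) :
    EqOn u v (Icc 0 T) := by
  have hV (t : ℝ) : LipschitzWith (max 1 K) (fun x : ℝ × ℝ ↦ (x.2, F t x.1)) := by
    have h2 := (hFl t).comp (LipschitzWith.prod_fst (α := ℝ) (β := ℝ))
    rw [mul_one] at h2
    exact LipschitzWith.prod_snd.prodMk h2
  have hc := ODE_solution_unique (a := 0) (b := T) (f := fun t ↦ (u t, p t))
    (g := fun t ↦ (v t, r t)) hV
    (h.cont_fst.prodMk h.cont_snd).continuousOn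
    (fun t ht ↦ by
      have := (h.fst t).prodMk (h.snd t)
      rw [hq t (Ico_subset_Icc_self ht)] at this
      exact this.hasDerivWithinAt)
    (k.cont_fst.prodMk k.cont_snd).continuousOn
    (fun t ht ↦ by
      have := (k.fst t).prodMk (k.snd t)
      rw [hs t (Ico_subset_Icc_self ht)] at this
      exact this.hasDerivWithinAt)
    (by simp only [h0, h1])
  exact fun t ht ↦ congrArg Prod.fst (hc ht)

section BoundaryValue

variable {F : ℝ → ℝ → ℝ} {K : ℝ≥0} {B T : ℝ} {l l1 l2 h h1 h2 : ℝ → ℝ}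

/-- The shooting family between strict lower and upper solutions, for a nonlinearity that keeps
its sign beyond them. -/
lemma exists_shooting_family_between
    (hFc : ∀ x, Continuous (F · x)) (hFl : ∀ t, LipschitzWith K (F t))
    (hFB : ∀ t x, |F t x| ≤ B) (hT : 0 < T)
    (hl : HasTwoDerivs l l1 l2) (hh : HasTwoDerivs h h1 h2)
    (hFlow : ∀ t ∈ Icc 0 T, ∀ x ≤ l t, F t x < l2 t)
    (hFhigh : ∀ t ∈ Icc 0 T, ∀ x, h t ≤ x → h2 t < F t x) (hlh : l 0 ≤ h 0)
    (hl0 : l1 0 = 0) (hh0 : h1 0 = 0) :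
    ∃ u p q : ℝ → ℝ → ℝ,
      (∀ α ∈ Icc (l 0) (h 0), HasTwoDerivs (u α) (p α) (q α) ∧ p α 0 = 0 ∧
        ∀ t ∈ Icc 0 T, q α t = F t (u α t) ∧ (u α t - l t ≤ 0 → q α t - l2 t < 0) ∧
          (h t - u α t ≤ 0 → h2 t - q α t < 0)) ∧
      ContinuousOn (u · T) (Icc (l 0) (h 0)) ∧ ContinuousOn (p · T) (Icc (l 0) (h 0)) ∧
      (p (l 0) T ≤ l1 T ∧ h1 T ≤ p (h 0) T) ∧ u (l 0) T ≤ l T ∧ h T ≤ u (h 0) T := by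
  obtain ⟨u, p, q, hu, hc⟩ := exists_shooting_family hFc hFl hFB hT
    (le_max_of_le_left (abs_nonneg (l 0)) : 0 ≤ max |l 0| |h 0|)
  set R := max |l 0| |h 0|
  have hsub : Icc (l 0) (h 0) ⊆ Icc (-R) R :=
    Icc_subset_Icc (neg_le.1 ((neg_le_abs _).trans (le_max_left _ _)))
      ((le_abs_self _).trans (le_max_right _ _))
  have hTT := right_mem_Icc.2 hT.le
  have low {α} (hα : α ∈ Icc (-R) R) : ∀ t ∈ Icc 0 T, u α t - l t ≤ 0 → q α t - l2 t < 0 :=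
    fun t ht hle ↦ by
      rw [(hu α hα).2.2.2 t ht]; linarith [hFlow t ht (u α t) (by linarith)]
  have high {α} (hα : α ∈ Icc (-R) R) : ∀ t ∈ Icc 0 T, h t - u α t ≤ 0 → h2 t - q α t < 0 :=
    fun t ht hle ↦ by
      rw [(hu α hα).2.2.2 t ht]; linarith [hFhigh t ht (u α t) (by linarith)]
  have hα := hsub (left_mem_Icc.2 hlh)
  have hβ := hsub (right_mem_Icc.2 hlh)
  obtain ⟨hd, hi, hp, -⟩ := hu _ hα
  obtain ⟨hd', hi', hp', -⟩ := hu _ hβ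
  have elow := (hd.sub hl).decreasing_of_nonpos hT (low hα) (by simp [hi]) (by simp [hp, hl0])
  have ehigh := (hh.sub hd').decreasing_of_nonpos hT (high hβ) (by simp [hi'])
    (by simp [hp', hh0])
  rw [hi] at elow
  rw [hi'] at ehigh
  refine ⟨u, p, q, fun α hα ↦ ?_, (hc T hTT).1.mono hsub, (hc T hTT).2.mono hsub,
    ⟨by linarith, by linarith⟩, by linarith, by linarith⟩
  obtain ⟨h1, -, h2, h3⟩ := hu α (hsub hα)
  exact ⟨h1, h2, fun t ht ↦ ⟨h3 t ht, low (hsub hα) t ht, high (hsub hα) t ht⟩⟩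

/-- Neumann problem between strict lower and upper solutions. -/
lemma exists_neumann_solution
    (hFc : ∀ x, Continuous (F · x)) (hFl : ∀ t, LipschitzWith K (F t))
    (hFB : ∀ t x, |F t x| ≤ B) (hT : 0 < T)
    (hl : HasTwoDerivs l l1 l2) (hh : HasTwoDerivs h h1 h2)
    (hFlow : ∀ t ∈ Icc 0 T, ∀ x ≤ l t, F t x < l2 t)
    (hFhigh : ∀ t ∈ Icc 0 T, ∀ x, h t ≤ x → h2 t < F t x) (hlh : l 0 ≤ h 0)
    (hl0 : l1 0 = 0) (hh0 : h1 0 = 0) (hlT : l1 T = 0) (hhT : h1 T = 0) :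
    ∃ u p q, HasTwoDerivs u p q ∧ p 0 = 0 ∧ p T = 0 ∧
      ∀ t ∈ Icc 0 T, q t = F t (u t) ∧ l t < u t ∧ u t < h t := by
  obtain ⟨u, p, q, hu, -, hc, he, -⟩ :=
    exists_shooting_family_between hFc hFl hFB hT hl hh hFlow hFhigh hlh hl0 hh0
  rw [hlT, hhT] at he
  obtain ⟨α, hα, hpT : p α T = 0⟩ := intermediate_value_Icc hlh hc he
  obtain ⟨hd, hp, hq⟩ := hu α hα
  refine ⟨u α, p α, q α, hd, hp, hpT, fun t ht ↦ ⟨(hq t ht).1, ?_, ?_⟩⟩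
  · exact sub_pos.1 ((hd.sub hl).pos_of_neumann hT (fun t ht ↦ (hq t ht).2.1)
      (by simp [hp, hl0]) (by simp [hpT, hlT]) t ht)
  · exact sub_pos.1 ((hh.sub hd).pos_of_neumann hT (fun t ht ↦ (hq t ht).2.2)
      (by simp [hp, hh0]) (by simp [hpT, hhT]) t ht)

/-- Mixed Neumann-Dirichlet problem between strict lower and upper solutions. -/
lemma exists_mixed_solution
    (hFc : ∀ x, Continuous (F · x)) (hFl : ∀ t, LipschitzWith K (F t))
    (hFB : ∀ t x, |F t x| ≤ B) (hT : 0 < T)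
    (hl : HasTwoDerivs l l1 l2) (hh : HasTwoDerivs h h1 h2)
    (hFlow : ∀ t ∈ Icc 0 T, ∀ x ≤ l t, F t x < l2 t)
    (hFhigh : ∀ t ∈ Icc 0 T, ∀ x, h t ≤ x → h2 t < F t x) (hlh : l 0 ≤ h 0)
    (hl0 : l1 0 = 0) (hh0 : h1 0 = 0) {c : ℝ} (hlT : l T < c) (hhT : c < h T) :
    ∃ u p q, HasTwoDerivs u p q ∧ p 0 = 0 ∧ u T = c ∧
      ∀ t ∈ Icc 0 T, q t = F t (u t) ∧ l t < u t ∧ u t < h t := by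
  obtain ⟨u, p, q, hu, hc, -, -, he⟩ :=
    exists_shooting_family_between hFc hFl hFB hT hl hh hFlow hFhigh hlh hl0 hh0
  obtain ⟨α, hα, huT : u α T = c⟩ :=
    intermediate_value_Icc hlh hc ⟨he.1.trans hlT.le, hhT.le.trans he.2⟩
  obtain ⟨hd, hp, hq⟩ := hu α hα
  refine ⟨u α, p α, q α, hd, hp, huT, fun t ht ↦ ⟨(hq t ht).1, ?_, ?_⟩⟩
  · exact sub_pos.1 ((hd.sub hl).pos_of_mixed (fun t ht ↦ (hq t ht).2.1)
      (by simp [hp, hl0]) (by simpa [huT] using hlT) t ht)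
  · exact sub_pos.1 ((hh.sub hd).pos_of_mixed (fun t ht ↦ (hq t ht).2.2)
      (by simp [hp, hh0]) (by simpa [huT] using hhT) t ht)

end BoundaryValue

/-- The Duffing acceleration `(x³ - λx + cos t)/ε²` with `x` truncated to `[l t, 2]`. -/
noncomputable def duffingForce (ε lam : ℝ) (l : ℝ → ℝ) (t x : ℝ) : ℝ :=
  (max (l t) (min x 2) ^ 3 - lam * max (l t) (min x 2) + Real.cos t) / ε ^ 2

section Duffing

variable {ε lam : ℝ} {l : ℝ → ℝ} {t x : ℝ}

lemma sq_mul_duffingForce (hε : 0 < ε) (h1 : l t ≤ x) (h2 : x ≤ 2) :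
    ε ^ 2 * duffingForce ε lam l t x = x ^ 3 - lam * x + Real.cos t := by
  rw [duffingForce, min_eq_left h2, max_eq_right h1]
  field_simp

lemma duffingForce_of_le (hl : l t ≤ 2) (h : x ≤ l t) :
    duffingForce ε lam l t x = (l t ^ 3 - lam * l t + Real.cos t) / ε ^ 2 := by
  rw [duffingForce, min_eq_left (h.trans hl), max_eq_left h]

lemma duffingForce_of_ge (hl : l t ≤ 2) (h : 2 ≤ x) :
    duffingForce ε lam l t x = (2 ^ 3 - lam * 2 + Real.cos t) / ε ^ 2 := by
  rw [duffingForce, min_eq_right h, max_eq_right hl]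

lemma duffingForce_pos_of_ge (hε : 0 < ε) (hlam : lam < 3) (hl : l t ≤ 2) (h : 2 ≤ x) :
    0 < duffingForce ε lam l t x := by
  rw [duffingForce_of_ge hl h]
  exact div_pos (by linarith [Real.neg_one_le_cos t]) (by positivity)

lemma continuous_duffingForce (hl : Continuous l) (x : ℝ) :
    Continuous (duffingForce ε lam l · x) := by
  unfold duffingForce
  fun_prop

lemma exists_duffingForce_bounds (hε : 0 < ε) (hl : ∀ t, l t ∈ Icc (-2) 2) :
    ∃ (K : ℝ≥0) (B : ℝ), (∀ t, LipschitzWith K (duffingForce ε lam l t)) ∧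
      ∀ t x, |duffingForce ε lam l t x| ≤ B := by
  have hy (t x : ℝ) : |max (l t) (min x 2)| ≤ 2 :=
    abs_le.2 ⟨(hl t).1.trans (le_max_left _ _), max_le (hl t).2 (min_le_right _ _)⟩
  refine ⟨.mk ((12 + |lam|) / ε ^ 2) (by positivity), (8 + |lam| * 2 + 1) / ε ^ 2,
    fun t ↦ LipschitzWith.of_dist_le_mul fun x x' ↦ ?_, fun t x ↦ ?_⟩
  · rw [Real.dist_eq, Real.dist_eq, NNReal.coe_mk, duffingForce, duffingForce, ← sub_div, abs_div,
      abs_of_pos (by positivity : 0 < ε ^ 2), div_mul_eq_mul_div]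
    have hd := abs_clamp_sub_clamp_le (l t) 2 x x'
    have h1 := hy t x
    have h2 := hy t x'
    set y := max (l t) (min x 2)
    set y' := max (l t) (min x' 2)
    gcongr
    have hfac : y ^ 3 - lam * y + Real.cos t - (y' ^ 3 - lam * y' + Real.cos t) =
      (y ^ 2 + y * y' + y' ^ 2 - lam) * (y - y') := by ring
    rw [hfac, abs_mul]
    have hq : |y ^ 2 + y * y' + y' ^ 2| ≤ 12 := by
      rw [abs_le] at h1 h2 ⊢
      constructor <;> nlinarith [sq_nonneg (y + y'), sq_nonneg (y - y')]
    have := (abs_sub (y ^ 2 + y * y' + y' ^ 2) lam).trans (add_le_add_left hq _)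
    gcongr
  · rw [duffingForce, abs_div, abs_of_pos (by positivity : 0 < ε ^ 2)]
    have h1 := hy t x
    set y := max (l t) (min x 2)
    gcongr
    have h3 : |y ^ 3| ≤ 8 := by
      rw [abs_pow]
      exact (pow_le_pow_left₀ (abs_nonneg y) h1 3).trans (by norm_num)
    have h4 : |lam * y| ≤ |lam| * 2 := by rw [abs_mul]; gcongr
    calc |y ^ 3 - lam * y + Real.cos t| ≤ |y ^ 3 - lam * y| + |Real.cos t| := abs_add_le _ _
      _ ≤ (|y ^ 3| + |lam * y|) + 1 := add_le_add (abs_sub _ _) (Real.abs_cos_le_one t)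
      _ ≤ _ := by gcongr

lemma hasTwoDerivs_sub_mul_cos (a η : ℝ) :
    HasTwoDerivs (fun t ↦ a - η * Real.cos t) (fun t ↦ η * Real.sin t)
      (fun t ↦ η * Real.cos t) where
  fst t := by simpa using ((Real.hasDerivAt_cos t).const_mul η).const_sub a
  snd t := (Real.hasDerivAt_sin t).const_mul η
  cont := by fun_prop

/-- A solution of the Neumann problem above a strict lower solution `a - η cos t`. -/
lemma exists_duffing_neumann_above {a η : ℝ} (hε : 0 < ε) (hlam : lam < 3)
    (hw : ∀ t, a - η * Real.cos t ∈ Icc (-2) 2)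
    (hlow : ∀ t, (a - η * Real.cos t) ^ 3 - lam * (a - η * Real.cos t) + Real.cos t <
      ε ^ 2 * (η * Real.cos t)) :
    ∃ u p q, HasTwoDerivs u p q ∧ p 0 = 0 ∧ p π = 0 ∧
      ∀ t ∈ Icc 0 π, ε ^ 2 * q t = u t ^ 3 - lam * u t + Real.cos t ∧
        a - η * Real.cos t < u t ∧ u t < 2 := by
  obtain ⟨K, B, hK, hB⟩ := exists_duffingForce_bounds (lam := lam) hε hw
  have hw2 := hasTwoDerivs_sub_mul_cos a η
  obtain ⟨u, p, q, h, h0, h1, hq⟩ := exists_neumann_solution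
    (continuous_duffingForce hw2.cont_fst) hK hB Real.pi_pos hw2 (.const 2)
    (fun t _ x hx ↦ by
      rw [duffingForce_of_le (l := fun t ↦ a - η * Real.cos t) (hw t).2 hx,
        div_lt_iff₀' (by positivity)]
      exact hlow t)
    (fun t _ x hx ↦ duffingForce_pos_of_ge hε hlam (hw t).2 hx) (hw 0).2 (by simp) rfl
    (by simp) rfl
  refine ⟨u, p, q, h, h0, h1, fun t ht ↦ ?_⟩
  obtain ⟨h2, h3, h4⟩ := hq t ht
  exact ⟨by rw [h2, sq_mul_duffingForce hε (l := fun t ↦ a - η * Real.cos t) h3.le h4.le],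
    h3, h4⟩

/-- A solution of the Neumann problem which is odd about `π / 2`. -/
lemma exists_duffing_neumann_odd (hε : 0 < ε) (hlam : lam < 3) :
    ∃ u p q, HasTwoDerivs u p q ∧ p 0 = 0 ∧ p π = 0 ∧ u (π / 2) = 0 ∧
      ∀ t ∈ Icc 0 π, ε ^ 2 * q t = u t ^ 3 - lam * u t + Real.cos t ∧ -2 < u t ∧ u t < 2 := by
  obtain ⟨K, B, hK, hB⟩ := exists_duffingForce_bounds (lam := lam) (l := fun _ ↦ -2) hε
    fun _ ↦ by norm_num
  obtain ⟨u, p, q, h, h0, h1, hq⟩ := exists_mixed_solution (c := 0)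
    (continuous_duffingForce continuous_const) hK hB Real.pi_div_two_pos (.const (-2)) (.const 2)
    (fun t _ x hx ↦ by
      rw [duffingForce_of_le (l := fun _ ↦ -2) (by norm_num) hx]
      exact div_neg_of_neg_of_pos (by linarith [Real.cos_le_one t]) (by positivity))
    (fun t _ x hx ↦ duffingForce_pos_of_ge hε hlam (by norm_num) hx) (by norm_num) rfl rfl
    (by norm_num) (by norm_num)
  have hq' : ∀ t ∈ Icc 0 (π / 2),
      ε ^ 2 * q t = u t ^ 3 - lam * u t + Real.cos t ∧ -2 < u t ∧ u t < 2 := fun t ht ↦ by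
    obtain ⟨h2, h3, h4⟩ := hq t ht
    exact ⟨by rw [h2, sq_mul_duffingForce hε (l := fun _ ↦ -2) h3.le h4.le], h3, h4⟩
  have hpi := Real.pi_pos
  have hmid : π - π / 2 = π / 2 := by ring
  have hq0 : q (π / 2) = 0 := by
    have := (hq' (π / 2) ⟨by positivity, le_rfl⟩).1
    rw [h1, Real.cos_pi_div_two] at this
    have hε2 : ε ^ 2 ≠ 0 := by positivity
    simpa [hε2] using this
  refine ⟨_, _, _, h.glue (c := π / 2) (h.comp_const_sub π).neg (by simp [hmid, h1])
    (by simp [hmid]) (by simp [hmid, hq0]), ?_, ?_, ?_, fun t ht ↦ ?_⟩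
  · rw [if_pos (by positivity), h0]
  · rw [if_neg (by linarith)]; simp [h0]
  · rw [if_pos le_rfl, h1]
  · by_cases htc : t ≤ π / 2
    · simp only [if_pos htc]
      exact hq' t ⟨ht.1, htc⟩
    · simp only [if_neg htc]
      obtain ⟨h2, h3, h4⟩ := hq' (π - t) ⟨by linarith [ht.2], by linarith⟩
      rw [Real.cos_pi_sub] at h2
      exact ⟨by linear_combination -h2, by linarith, by linarith⟩

/-- Two bounded solutions with the same initial data agree. -/
lemma duffing_eqOn {u p q v r s : ℝ → ℝ} (hε : 0 < ε)
    (h : HasTwoDerivs u p q) (k : HasTwoDerivs v r s)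
    (hq : ∀ t ∈ Icc 0 π,
      ε ^ 2 * q t = u t ^ 3 - lam * u t + Real.cos t ∧ -2 < u t ∧ u t < 2)
    (hs : ∀ t ∈ Icc 0 π,
      ε ^ 2 * s t = v t ^ 3 - lam * v t + Real.cos t ∧ -2 < v t ∧ v t < 2)
    (h0 : u 0 = v 0) (h1 : p 0 = r 0) : EqOn u v (Icc 0 π) := by
  obtain ⟨K, B, hK, -⟩ := exists_duffingForce_bounds (lam := lam) (l := fun _ ↦ -2) hε
    fun _ ↦ by norm_num
  have hε2 : ε ^ 2 ≠ 0 := by positivity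
  refine h.eqOn_of_initial hK k (fun t ht ↦ ?_) (fun t ht ↦ ?_) h0 h1
  · obtain ⟨h2, h3, h4⟩ := hq t ht
    exact mul_left_cancel₀ hε2
      (by rw [h2, sq_mul_duffingForce hε (l := fun _ ↦ -2) h3.le h4.le])
  · obtain ⟨h2, h3, h4⟩ := hs t ht
    exact mul_left_cancel₀ hε2
      (by rw [h2, sq_mul_duffingForce hε (l := fun _ ↦ -2) h3.le h4.le])

/-- The perturbation `a - η cos t` of the double root `a` is a strict lower solution near the
critical parameter `3 a²`. -/
lemma duffing_lower_solution {a η δ c : ℝ} (ha1 : a < 1) (ha3 : a ^ 3 = 1 / 2)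
    (hη0 : 0 < η) (hη1 : η < 1 / 4) (hη : ε ^ 2 * η ≤ 1) (hηε : 8 * η ≤ ε ^ 2)
    (hδ : 8 * δ = ε ^ 2 * η) (h1 : 3 * a ^ 2 - δ < lam) (h2 : lam ≤ 3 * a ^ 2)
    (hc : c ∈ Icc (-1 : ℝ) 1) :
    (a - η * c) ^ 3 - lam * (a - η * c) + c < ε ^ 2 * (η * c) := by
  obtain ⟨hc1, hc2⟩ := hc
  have hcube : (a - η * c) ^ 3 - lam * (a - η * c) + c =
      -1 + c + η ^ 2 * c ^ 2 * (3 * a - η * c) + (3 * a ^ 2 - lam) * (a - η * c) := by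
    linear_combination (-2) * ha3
  have hηc : |η * c| ≤ η := by
    rw [abs_mul, abs_of_pos hη0]
    exact mul_le_of_le_one_right hη0.le (abs_le.2 ⟨hc1, hc2⟩)
  obtain ⟨hb1, hb2⟩ := abs_le.1 hηc
  have hδ0 : 0 < δ := by linarith
  have e1 : η ^ 2 * c ^ 2 * (3 * a - η * c) ≤ η ^ 2 * 4 := by
    have hsq : η ^ 2 * c ^ 2 ≤ η ^ 2 := mul_le_of_le_one_right (by positivity) (by nlinarith)
    calc η ^ 2 * c ^ 2 * (3 * a - η * c) ≤ η ^ 2 * c ^ 2 * 4 := by gcongr; linarith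
      _ ≤ η ^ 2 * 4 := by gcongr
  have e2 : (3 * a ^ 2 - lam) * (a - η * c) ≤ δ * 2 :=
    calc (3 * a ^ 2 - lam) * (a - η * c) ≤ (3 * a ^ 2 - lam) * 2 := by
          gcongr
          linarith
      _ ≤ δ * 2 := by gcongr; linarith
  have e3 : 0 ≤ (1 - c) * (1 - ε ^ 2 * η) := mul_nonneg (by linarith) (by linarith)
  have e4 : 8 * η * η ≤ ε ^ 2 * η := by gcongr
  rw [hcube]
  nlinarith

end Duffing

lemma critical_parameter_eq :
    (3 : ℝ) / (2 : ℝ) ^ ((2 : ℝ) / 3) = 3 * ((2 : ℝ) ^ (-(1 / 3) : ℝ)) ^ 2 := by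
  rw [← Real.rpow_natCast, ← Real.rpow_mul (by norm_num), div_eq_mul_inv,
    ← Real.rpow_neg (by norm_num)]
  norm_num

/-- For every `ε > 0` there is `δ > 0` such that for every
`λ ∈ (λ₀ − δ, λ₀]` (with `λ₀ = 3/2^(2/3)`) there are at least three distinct
initial values `α` whose solutions `u_α` of the Duffing equation (with
`u_α(0) = α`, `u_α'(0) = 0`) are defined on `[0,π]` and satisfy `u_α'(π) = 0`. -/
theorem stmt_7 (ε : ℝ) (hε : 0 < ε) :
    ∃ δ > (0 : ℝ), ∀ lam : ℝ,
      (3 : ℝ) / (2 : ℝ) ^ ((2 : ℝ) / 3) - δ < lam →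
      lam ≤ (3 : ℝ) / (2 : ℝ) ^ ((2 : ℝ) / 3) →
      ∃ s : Finset ℝ, 3 ≤ s.card ∧
        ∀ α ∈ s, ∃ u : ℝ → ℝ, ContDiff ℝ 2 u ∧
          (∀ t ∈ Icc (0 : ℝ) π,
            ε ^ 2 * deriv (deriv u) t = u t ^ 3 - lam * u t + Real.cos t) ∧
          u 0 = α ∧ deriv u 0 = 0 ∧ deriv u π = 0 := by
  set a : ℝ := (2 : ℝ) ^ (-(1 / 3) : ℝ) with ha
  have ha0 : 0 < a := by positivity
  have ha1 : a < 1 := Real.rpow_lt_one_of_one_lt_of_neg (by norm_num) (by norm_num)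
  have ha3 : a ^ 3 = 1 / 2 := by
    rw [ha, ← Real.rpow_natCast, ← Real.rpow_mul (by norm_num)]
    norm_num [Real.rpow_neg_one]
  rw [critical_parameter_eq]
  set η : ℝ := ε ^ 2 / (8 * (1 + ε ^ 4)) with hη
  have hη0 : 0 < η := by positivity
  have hη1 : η < 1 / 4 := by
    rw [hη, div_lt_iff₀ (by positivity)]; nlinarith [sq_nonneg (ε ^ 2 - 1)]
  have hεη : ε ^ 2 * η ≤ 1 := by
    rw [hη, mul_div_assoc', div_le_one (by positivity)]; nlinarith [sq_nonneg (ε ^ 2)]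
  have hηε : 8 * η ≤ ε ^ 2 := by
    rw [hη, mul_div_assoc', div_le_iff₀ (by positivity)]
    nlinarith [mul_nonneg (sq_nonneg ε) (sq_nonneg (ε ^ 2))]
  refine ⟨ε ^ 2 * η / 8, by positivity, fun lam h1 h2 ↦ ?_⟩
  have hlam : lam < 3 := by nlinarith
  have hcos (t : ℝ) : |η * Real.cos t| ≤ η := by
    rw [abs_mul, abs_of_pos hη0]
    exact mul_le_of_le_one_right hη0.le (Real.abs_cos_le_one t)
  have hw (t : ℝ) : a - η * Real.cos t ∈ Icc (-2) 2 := by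
    obtain ⟨hb1, hb2⟩ := abs_le.1 (hcos t)
    constructor <;> linarith
  obtain ⟨u, p, q, hu, hp0, hpπ, hq⟩ := exists_duffing_neumann_above hε hlam hw fun t ↦
    duffing_lower_solution ha1 ha3 hη0 hη1 hεη hηε (mul_div_cancel₀ _ (by norm_num)) h1 h2
      ⟨Real.neg_one_le_cos t, Real.cos_le_one t⟩
  obtain ⟨v, r, s, hv, hr0, hrπ, hvm, hs⟩ := exists_duffing_neumann_odd hε hlam
  have hpi := Real.pi_pos
  have hreflect (t : ℝ) (ht : t ∈ Icc 0 π) : π - t ∈ Icc 0 π :=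
    ⟨by linarith [ht.2], by linarith [ht.1]⟩
  have hq' : ∀ t ∈ Icc 0 π, ε ^ 2 * q t = u t ^ 3 - lam * u t + Real.cos t ∧
      -2 < u t ∧ u t < 2 := fun t ht ↦
    ⟨(hq t ht).1, (hw t).1.trans_lt (hq t ht).2.1, (hq t ht).2.2⟩
  have hu' := (hu.comp_const_sub π).neg
  have hqr : ∀ t ∈ Icc 0 π, ε ^ 2 * -q (π - t) =
      (-u (π - t)) ^ 3 - lam * -u (π - t) + Real.cos t ∧
      -2 < -u (π - t) ∧ -u (π - t) < 2 := fun t ht ↦ by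
    obtain ⟨e1, e2, e3⟩ := hq' _ (hreflect t ht)
    rw [Real.cos_pi_sub] at e1
    exact ⟨by linear_combination -e1, by linarith, by linarith⟩
  have hpos (t : ℝ) (ht : t ∈ Icc 0 π) : 0 < u t := by
    have := (abs_le.1 (hcos t)).2
    have ha4 : 1 / 4 < a := by
      by_contra! hle
      nlinarith [pow_le_pow_left₀ ha0.le hle 3]
    linarith [(hq t ht).2.1]
  have h0mem : (0 : ℝ) ∈ Icc 0 π := left_mem_Icc.2 hpi.le
  have hmid : π / 2 ∈ Icc 0 π := ⟨by positivity, by linarith⟩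
  have hne1 : u 0 ≠ -u π := fun h ↦ by
    have := hpos 0 h0mem
    have := hpos π (right_mem_Icc.2 hpi.le)
    linarith
  have hne2 : u 0 ≠ v 0 := fun h ↦ by
    have := duffing_eqOn hε hu hv hq' hs h (by rw [hp0, hr0]) hmid
    linarith [hpos _ hmid]
  have hne3 : -u π ≠ v 0 := fun h ↦ by
    have := duffing_eqOn hε hu' hv hqr hs (by simpa using h) (by simp [hpπ, hr0]) hmid
    linarith [hpos _ (hreflect _ hmid)]
  refine ⟨{u 0, -u π, v 0}, (Finset.card_eq_three.2 ⟨_, _, _, hne1, hne2, hne3, rfl⟩).ge, ?_⟩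
  intro α hα
  simp only [Finset.mem_insert, Finset.mem_singleton] at hα
  rcases hα with rfl | rfl | rfl
  · refine ⟨u, hu.contDiff, fun t ht ↦ ?_, rfl, ?_, ?_⟩
    · rw [hu.deriv_deriv_eq, (hq' t ht).1]
    · rw [hu.deriv_eq, hp0]
    · rw [hu.deriv_eq, hpπ]
  · refine ⟨_, hu'.contDiff, fun t ht ↦ ?_, by simp, ?_, ?_⟩
    · rw [hu'.deriv_deriv_eq, (hqr t ht).1]
    · rw [hu'.deriv_eq]; simp [hpπ]
    · rw [hu'.deriv_eq]; simp [hp0]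
  · refine ⟨v, hv.contDiff, fun t ht ↦ ?_, rfl, ?_, ?_⟩
    · rw [hv.deriv_deriv_eq, (hs t ht).1]
    · rw [hv.deriv_eq, hr0]
    · rw [hv.deriv_eq, hrπ]
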